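/- arXiv:2304.11757 — 7 statements merged into one kernel-verified Lean document; each statement's English description precedes it below -/
import Mathlib

section
/- Let P, Q ⊆ ℝⁿ where P = conv(V_P) for a finite nonempty set V_P and also P = {x : ⟨hP_j, x⟩ ≤ bP_j for all j}, and Q = conv(V_Q) for a finite nonempty set V_Q and also Q = {x : ⟨hQ_i, x⟩ ≤ bQ_i for all i}. If s ∈ ℝⁿ is such that (P ⊕ {s}) ∩ Q ≠ ∅, then ⟨hQ_i, s⟩ ≤ bQ_i − α_i for every i, where α_i = min_{v ∈ V_P} ⟨hQ_i, v⟩, and −⟨hP_j, s⟩ ≤ bP_j − γ_j for every j, where γ_j = min_{w ∈ V_Q} ⟨hP_j, w⟩. (This is one inclusion of the characterization of the overlap set 𝓞(P, Q).) -/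
open Pointwise

/-- A linear functional on a convex hull is bounded below by its minimum over the generators. -/
theorem inf'_dotProduct_le_of_mem_convexHull {ι : Type*} [Fintype ι] {V : Finset (ι → ℝ)}
    (hV : V.Nonempty) (h : ι → ℝ) {x : ι → ℝ} (hx : x ∈ convexHull ℝ (V : Set (ι → ℝ))) :
    V.inf' hV (fun v => ∑ k, h k * v k) ≤ ∑ k, h k * x k := by
  have hlin : IsLinearMap ℝ fun y : ι → ℝ => ∑ k, h k * y k :=
    ⟨fun y z => dotProduct_add h y z, fun c y => dotProduct_smul c h y⟩
  exact convexHull_min (fun v hv => Finset.inf'_le (fun v => ∑ k, h k * v k) hv)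
    (convex_halfSpace_ge hlin _) hx

/-- Proposition 2, one inclusion: if the translate `P ⊕ {s}` meets `Q`, then `s`
satisfies the given linear inequalities coming from the halfspace
representations of `P` and `Q` and the vertex sets `V_P`, `V_Q`. -/
theorem overlap_set_necessary_conditions
    (n NP NQ : ℕ) (VP VQ : Finset (Fin n → ℝ)) (hVP : VP.Nonempty) (hVQ : VQ.Nonempty)
    (hP : Fin NP → (Fin n → ℝ)) (bP : Fin NP → ℝ)
    (hQ : Fin NQ → (Fin n → ℝ)) (bQ : Fin NQ → ℝ)
    (P Q : Set (Fin n → ℝ))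
    (hPdef : P = convexHull ℝ (VP : Set (Fin n → ℝ)))
    (hPhalf : P = {x | ∀ j, ∑ k, hP j k * x k ≤ bP j})
    (hQdef : Q = convexHull ℝ (VQ : Set (Fin n → ℝ)))
    (hQhalf : Q = {x | ∀ i, ∑ k, hQ i k * x k ≤ bQ i})
    (s : Fin n → ℝ)
    (hs : ((P + ({s} : Set (Fin n → ℝ))) ∩ Q).Nonempty) :
    (∀ i, ∑ k, hQ i k * s k ≤ bQ i - VP.inf' hVP (fun v => ∑ k, hQ i k * v k)) ∧
    (∀ j, -(∑ k, hP j k * s k) ≤ bP j - VQ.inf' hVQ (fun w => ∑ k, hP j k * w k)) := by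
  obtain ⟨_, ⟨p, hp, s, rfl, rfl⟩, hq⟩ := hs
  have hp' : ∀ j, ∑ k, hP j k * p k ≤ bP j := by rwa [hPhalf] at hp
  have hq' : ∀ i, ∑ k, hQ i k * (p + s) k ≤ bQ i := by rwa [hQhalf] at hq
  rw [hPdef] at hp
  rw [hQdef] at hq
  refine ⟨fun i => ?_, fun j => ?_⟩
  · have hmin := inf'_dotProduct_le_of_mem_convexHull hVP (hQ i) hp
    have hle := hq' i
    simp only [Pi.add_apply, mul_add, Finset.sum_add_distrib] at hle
    linarith
  · have hmin := inf'_dotProduct_le_of_mem_convexHull hVQ (hP j) hq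
    have hle := hp' j
    simp only [Pi.add_apply, mul_add, Finset.sum_add_distrib] at hmin
    linarith
end

section
/- Let A ⊆ ℝⁿ be nonempty and bounded, let B ⊆ ℝⁿ be closed and convex, and let r ∈ ℝⁿ. If a + r ∈ A ⊕ B for every a ∈ A (i.e., A ⊕ {r} ⊆ A ⊕ B), then r ∈ B. -/
open Pointwise

/-- Cancellation for Minkowski sums in a real normed space: a translation that maps a nonempty
bounded set `A` into `A + B`, with `B` closed and convex, is a translation by an element of `B`. -/
theorem mem_of_add_singleton_subset_add {E : Type*} [NormedAddCommGroup E] [NormedSpace ℝ E]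
    {A B : Set E} {r : E} (hA : A.Nonempty) (hAb : Bornology.IsBounded A)
    (hBclosed : IsClosed B) (hBconv : Convex ℝ B) (h : A + {r} ⊆ A + B) : r ∈ B := by
  by_contra hr
  obtain ⟨f, u, hB, hu⟩ := geometric_hahn_banach_closed_point hBconv hBclosed hr
  have hbdd : BddAbove (f '' A) := (f.lipschitz.isBounded_image hAb).bddAbove
  obtain ⟨_, ⟨a, ha, rfl⟩, hlt⟩ :=
    exists_lt_of_lt_csSup (hA.image f) (sub_lt_self (sSup (f '' A)) (sub_pos.2 hu))
  obtain ⟨a', ha', b, hb, hab⟩ := h (Set.add_mem_add ha (Set.mem_singleton r))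
  have hf : f a' + f b = f a + f r := by simpa using congrArg f hab
  linarith [hB b hb, le_csSup hbdd (Set.mem_image_of_mem f ha')]

/-- Minkowski-sum cancellation: if `A` is nonempty and bounded, `B` is closed and
convex, and `A ⊕ {r} ⊆ A ⊕ B`, then `r ∈ B`. -/
theorem minkowski_cancellation
    (n : ℕ) (A B : Set (Fin n → ℝ))
    (hA : A.Nonempty) (hAb : Bornology.IsBounded A)
    (hBclosed : IsClosed B) (hBconv : Convex ℝ B)
    (r : Fin n → ℝ)
    (h : A + ({r} : Set (Fin n → ℝ)) ⊆ A + B) :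
    r ∈ B := by
  exact mem_of_add_singleton_subset_add hA hAb hBclosed hBconv h
end

section
/- Let P₀ ⊆ ℝⁿ be nonempty and bounded, let W ⊆ ℝⁿ be compact and convex, and let Ω ⊆ ℝⁿ be an arbitrary set. Then there exists w ∈ W with P₀ ⊕ {w} ⊆ Ω if and only if there exists r ∈ ℝⁿ with P₀ ⊕ {r} ⊆ Ω ∩ (P₀ ⊕ W). -/
open Pointwise

/-- Order cancellation: a bounded nonempty summand can be cancelled from `P + {r} ⊆ P + W`
when `W` is closed and convex. -/
theorem mem_of_add_singleton_subset_add_s4 {E : Type*} [NormedAddCommGroup E] [NormedSpace ℝ E]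
    {P W : Set E} {r : E} (hP : P.Nonempty) (hPb : Bornology.IsBounded P)
    (hW : IsClosed W) (hWc : Convex ℝ W) (h : P + {r} ⊆ P + W) : r ∈ W := by
  by_contra hr
  obtain ⟨f, u, hfW, hur⟩ := geometric_hahn_banach_closed_point hWc hW hr
  have hbdd : BddAbove (f '' P) := (f.lipschitz.isBounded_image hPb).bddAbove
  have hle : sSup (f '' P) ≤ sSup (f '' P) + u - f r := by
    refine csSup_le (hP.image f) ?_
    rintro _ ⟨p, hp, rfl⟩
    obtain ⟨q, hq, w, hw, hqw⟩ := h (Set.add_mem_add hp (Set.mem_singleton r))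
    have hf : f q + f w = f p + f r := by
      rw [← map_add, ← map_add]
      exact congrArg f hqw
    linarith [le_csSup hbdd (Set.mem_image_of_mem f hq), hfW w hw]
  linarith

/-- There is an invariance-enforcing translation `w ∈ W` with `P₀ ⊕ {w} ⊆ Ω`
iff there is some translation `r` with `P₀ ⊕ {r} ⊆ Ω ∩ (P₀ ⊕ W)`. -/
theorem translation_into_intersection_iff
    (n : ℕ) (P₀ W Ω : Set (Fin n → ℝ))
    (hP : P₀.Nonempty) (hPb : Bornology.IsBounded P₀)
    (hW : IsCompact W) (hWc : Convex ℝ W) :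
    (∃ w ∈ W, P₀ + ({w} : Set (Fin n → ℝ)) ⊆ Ω) ↔
      (∃ r : Fin n → ℝ, P₀ + ({r} : Set (Fin n → ℝ)) ⊆ Ω ∩ (P₀ + W)) := by
  constructor
  · rintro ⟨w, hw, h⟩
    exact ⟨w, Set.subset_inter h (Set.add_subset_add_left (Set.singleton_subset_iff.2 hw))⟩
  · rintro ⟨r, h⟩
    obtain ⟨hΩ, hPW⟩ := Set.subset_inter_iff.1 h
    exact ⟨r, mem_of_add_singleton_subset_add_s4 hP hPb hW.isClosed hWc hPW, hΩ⟩
end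

section
/- Let f₀ : ℝⁿ → ℝⁿ and g₁,…,g_m : ℝⁿ → ℝⁿ, let X ⊆ ℝⁿ be nonempty, let A be an n×n real matrix, let Φ ⊆ ℝⁿ satisfy f₀(x) − Ax ∈ Φ for all x ∈ X and ‖p − q‖_∞ ≤ a for all p, q ∈ Φ, let s₁,…,s_m ∈ ℝⁿ and Ψ₁,…,Ψ_m ⊆ ℝⁿ satisfy g_i(x) − s_i ∈ Ψ_i for all x ∈ X and all i, with ‖w‖_∞ ≤ c_i for all w ∈ Ψ_i, and let 𝒰 ⊆ ℝᵐ satisfy |u_i| ≤ M_i for all u ∈ 𝒰 and all i. Then for every u ∈ 𝒰, every point z ∈ P̄_u(X) = {A y + p + Σ_i u_i s_i + Σ_i v_i w_i : y ∈ X, p ∈ Φ, v ∈ 𝒰, w_i ∈ Ψ_i} lies within ∞-norm distance δ = a + 2 Σ_{i=1}^m c_i M_i of the set P_u(X) = {f₀(y) + Σ_i u_i g_i(y) : y ∈ X}; that is, P̄_u(X) ⊆ P_u(X) ⊕ B_δ, where B_δ is the closed ∞-norm ball of radius δ centered at the origin. -/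
open Pointwise

/-- A linear combination of vectors bounded by `c i` with coefficients bounded by `M i` has norm at
most `∑ i, c i * M i`. -/
theorem norm_sum_smul_le_sum_mul {ι E : Type*} [Fintype ι] [SeminormedAddCommGroup E]
    [NormedSpace ℝ E] {c M v : ι → ℝ} {w : ι → E} (hw : ∀ i, ‖w i‖ ≤ c i)
    (hv : ∀ i, |v i| ≤ M i) : ‖∑ i, v i • w i‖ ≤ ∑ i, c i * M i := by
  refine norm_sum_le_of_le _ fun i _ => ?_
  rw [norm_smul, Real.norm_eq_abs, mul_comm]
  exact mul_le_mul (hw i) (hv i) (abs_nonneg _) ((norm_nonneg _).trans (hw i))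

/-- Lemma 2, second inclusion: the overapproximation `P̄_u(X)` lies within
∞-norm distance `δ = a + 2 Σ_i c_i M_i` of the exact fixed-control reachable
set `P_u(X)`, i.e. `P̄_u(X) ⊆ P_u(X) ⊕ B_δ`. (The norm on `Fin n → ℝ` is the
sup norm.) -/
theorem overapprox_subset_reachable_plus_ball
    (n m : ℕ) (f₀ : (Fin n → ℝ) → (Fin n → ℝ))
    (g : Fin m → (Fin n → ℝ) → (Fin n → ℝ))
    (X : Set (Fin n → ℝ)) (hX : X.Nonempty)
    (A : Matrix (Fin n) (Fin n) ℝ)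
    (Φ : Set (Fin n → ℝ)) (hΦ : ∀ x ∈ X, f₀ x - A.mulVec x ∈ Φ)
    (a : ℝ) (ha : ∀ p ∈ Φ, ∀ q ∈ Φ, ‖p - q‖ ≤ a)
    (s : Fin m → (Fin n → ℝ)) (Ψ : Fin m → Set (Fin n → ℝ))
    (hΨ : ∀ x ∈ X, ∀ i, g i x - s i ∈ Ψ i)
    (c : Fin m → ℝ) (hc : ∀ i, ∀ w ∈ Ψ i, ‖w‖ ≤ c i)
    (𝒰 : Set (Fin m → ℝ)) (M : Fin m → ℝ) (hM : ∀ u ∈ 𝒰, ∀ i, |u i| ≤ M i)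
    (δ : ℝ) (hδ : δ = a + 2 * ∑ i, c i * M i) :
    ∀ u ∈ 𝒰,
      {z : Fin n → ℝ | ∃ y ∈ X, ∃ p ∈ Φ, ∃ v ∈ 𝒰, ∃ w : Fin m → (Fin n → ℝ),
          (∀ i, w i ∈ Ψ i) ∧
          z = A.mulVec y + p + (∑ i, u i • s i) + ∑ i, v i • w i} ⊆
        {z : Fin n → ℝ | ∃ y ∈ X, z = f₀ y + ∑ i, u i • g i y} +
          {z : Fin n → ℝ | ‖z‖ ≤ δ} := by
  rintro u hu z ⟨y, hy, p, hp, v, hv, w, hw, rfl⟩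
  refine Set.mem_add.mpr ⟨f₀ y + ∑ i, u i • g i y, ⟨y, hy, rfl⟩,
    (p - (f₀ y - A.mulVec y)) + (∑ i, v i • w i - ∑ i, u i • (g i y - s i)), ?_, ?_⟩
  · have h₁ := ha p hp _ (hΦ y hy)
    have h₂ := norm_sum_smul_le_sum_mul (fun i => hc i _ (hw i)) (hM v hv)
    have h₃ := norm_sum_smul_le_sum_mul (fun i => hc i _ (hΨ y hy i)) (hM u hu)
    have h₄ := norm_add_le_of_le h₁ (norm_sub_le_of_le h₂ h₃)
    rw [Set.mem_ofPred_eq, hδ, two_mul]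
    exact h₄
  · simp only [smul_sub, Finset.sum_sub_distrib]
    abel
end

section
/- Let f : ℝⁿ × ℝᵐ → ℝⁿ be continuous, let 𝒰 ⊆ ℝᵐ be compact, and let Ω ⊆ ℝⁿ be closed. Define I(S) = Q(S) ∩ S where Q(S) = {x : ∃ u ∈ 𝒰, f(x, u) ∈ S}, and set I⁰(Ω) = Ω, I^{k+1}(Ω) = I(I^k(Ω)). Then the set I^∞(Ω) = ⋂_{k ≥ 0} I^k(Ω) is controlled invariant: for every x ∈ I^∞(Ω) there exists u ∈ 𝒰 such that f(x, u) ∈ I^∞(Ω). -/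
/-- The pre-set of a closed set under continuous dynamics with compact inputs is closed. -/
theorem isClosed_setOf_exists_mem_of_isCompact {X Y Z : Type*} [TopologicalSpace X]
    [TopologicalSpace Y] [TopologicalSpace Z] {f : X × Y → Z} (hf : Continuous f)
    {K : Set Y} (hK : IsCompact K) {S : Set Z} (hS : IsClosed S) :
    IsClosed {x | ∃ u ∈ K, f (x, u) ∈ S} := by
  have : CompactSpace K := isCompact_iff_compactSpace.mp hK
  have hclosed : IsClosed {p : X × K | f (p.1, p.2) ∈ S} := hS.preimage (by fun_prop)
  convert isClosedMap_fst_of_compactSpace _ hclosed using 1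
  ext x
  simp

/-- The limit set `I^∞(Ω) = ⋂ₖ I^k(Ω)` of the backward iteration is controlled
invariant, for continuous dynamics, compact input set, and closed `Ω`. -/
theorem limit_set_controlled_invariant
    (n m : ℕ) (f : (Fin n → ℝ) × (Fin m → ℝ) → (Fin n → ℝ))
    (hf : Continuous f)
    (𝒰 : Set (Fin m → ℝ)) (h𝒰 : IsCompact 𝒰)
    (Ω : Set (Fin n → ℝ)) (hΩ : IsClosed Ω)
    (I : Set (Fin n → ℝ) → Set (Fin n → ℝ))
    (hI : ∀ S, I S = {x | ∃ u ∈ 𝒰, f (x, u) ∈ S} ∩ S) :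
    ∀ x ∈ ⋂ k : ℕ, I^[k] Ω, ∃ u ∈ 𝒰, f (x, u) ∈ ⋂ k : ℕ, I^[k] Ω := by
  have hsucc (k : ℕ) : I^[k + 1] Ω = {x | ∃ u ∈ 𝒰, f (x, u) ∈ I^[k] Ω} ∩ I^[k] Ω := by
    rw [Function.iterate_succ_apply', hI]
  have hclosed (k : ℕ) : IsClosed (I^[k] Ω) := by
    induction k with
    | zero => exact hΩ
    | succ k ih =>
      rw [hsucc]
      exact (isClosed_setOf_exists_mem_of_isCompact hf h𝒰 ih).inter ih
  intro x hx
  have hinputs (k : ℕ) : IsClosed {u | f (x, u) ∈ I^[k] Ω} :=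
    (hclosed k).preimage (by fun_prop)
  obtain ⟨u, hu⟩ := IsCompact.nonempty_iInter_of_sequence_nonempty_isCompact_isClosed
    (fun k : ℕ => 𝒰 ∩ {u | f (x, u) ∈ I^[k] Ω})
    (fun k u hu => ⟨hu.1, by
      have h : f (x, u) ∈ I^[k + 1] Ω := hu.2
      rw [hsucc] at h
      exact h.2⟩)
    (fun k => by
      have h := Set.mem_iInter.mp hx (k + 1)
      rw [hsucc] at h
      exact h.1)
    (h𝒰.inter_right (hinputs 0))
    (fun k => h𝒰.isClosed.inter (hinputs k))
  rw [Set.mem_iInter] at hu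
  exact ⟨u, (hu 0).1, Set.mem_iInter.mpr fun k => (hu k).2⟩
end

section
/- Let f : ℝⁿ × ℝᵐ → ℝⁿ, 𝒰 ⊆ ℝᵐ, and let Ω₁,…,Ω_N ⊆ ℝⁿ with Ω = ⋃_{i=1}^N Ω_i. For k ≥ 0, let C^k denote the collection obtained from (Ω₁,…,Ω_N) by applying k full sweeps I_{1:N} (each sweep replaces, in order for i = 1,…,N, the i-th component by Q(current union) ∩ (current i-th component), where Q(S) = {x : ∃ u ∈ 𝒰, f(x, u) ∈ S}). If M ⊆ Ω is controlled invariant (for every x ∈ M there exists u ∈ 𝒰 with f(x, u) ∈ M), then M ⊆ ⋃_{j=1}^N C^k_j for every k ≥ 0; in fact M is contained in the union of the collection after every individual update step within every sweep. -/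
/-- The pre-set (one-step backward reachable set) operator. -/
def preSet {n m : ℕ} (f : (Fin n → ℝ) × (Fin m → ℝ) → (Fin n → ℝ))
    (𝒰 : Set (Fin m → ℝ)) (S : Set (Fin n → ℝ)) : Set (Fin n → ℝ) :=
  {x | ∃ u ∈ 𝒰, f (x, u) ∈ S}

/-- The operator `I_i`: replace the `i`-th component of the collection `C` by
`Q(⋃ⱼ Cⱼ) ∩ Cᵢ`, leaving the other components unchanged. -/
def stepAt {n m N : ℕ} (f : (Fin n → ℝ) × (Fin m → ℝ) → (Fin n → ℝ))
    (𝒰 : Set (Fin m → ℝ)) (C : Fin N → Set (Fin n → ℝ)) (i : Fin N) :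
    Fin N → Set (Fin n → ℝ) :=
  Function.update C i (preSet f 𝒰 (⋃ j, C j) ∩ C i)

/-- One full sweep `I_{1:N}`: apply `I_1, I_2, …, I_N` in order. -/
def sweep {n m N : ℕ} (f : (Fin n → ℝ) × (Fin m → ℝ) → (Fin n → ℝ))
    (𝒰 : Set (Fin m → ℝ)) (C : Fin N → Set (Fin n → ℝ)) :
    Fin N → Set (Fin n → ℝ) :=
  (List.finRange N).foldl (stepAt f 𝒰) C

/-- If every point of `M` has an admissible input keeping it in `M`, a single update step
preserves the inclusion of `M` in the union of the collection. -/
theorem subset_iUnion_stepAt {n m N : ℕ} {f : (Fin n → ℝ) × (Fin m → ℝ) → (Fin n → ℝ)}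
    {𝒰 : Set (Fin m → ℝ)} {M : Set (Fin n → ℝ)}
    (hinv : ∀ x ∈ M, ∃ u ∈ 𝒰, f (x, u) ∈ M) {C : Fin N → Set (Fin n → ℝ)}
    (hC : M ⊆ ⋃ j, C j) (i : Fin N) : M ⊆ ⋃ j, stepAt f 𝒰 C i j := by
  intro x hx
  obtain ⟨j, hj⟩ := Set.mem_iUnion.1 (hC hx)
  obtain ⟨u, hu, hfu⟩ := hinv x hx
  refine Set.mem_iUnion.2 ⟨j, ?_⟩
  rcases eq_or_ne j i with rfl | hji
  · rw [stepAt, Function.update_self]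
    exact ⟨⟨u, hu, hC hfu⟩, hj⟩
  · rwa [stepAt, Function.update_of_ne hji]

/-- Any finite sequence of update steps preserves the inclusion of a controlled invariant set
in the union of the collection. -/
theorem subset_iUnion_foldl_stepAt {n m N : ℕ}
    {f : (Fin n → ℝ) × (Fin m → ℝ) → (Fin n → ℝ)}
    {𝒰 : Set (Fin m → ℝ)} {M : Set (Fin n → ℝ)}
    (hinv : ∀ x ∈ M, ∃ u ∈ 𝒰, f (x, u) ∈ M) (l : List (Fin N))
    {C : Fin N → Set (Fin n → ℝ)} (hC : M ⊆ ⋃ j, C j) :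
    M ⊆ ⋃ j, l.foldl (stepAt f 𝒰) C j := by
  induction l generalizing C with
  | nil => exact hC
  | cons i l ih => exact ih (subset_iUnion_stepAt hinv hC i)

/- Any controlled invariant set `M ⊆ Ω = ⋃ᵢ Ωᵢ` is contained in the union of
the collection after any number `k` of full sweeps, and indeed after every
individual update step (prefix of length `t`) within every sweep. -/
theorem controlled_invariant_subset_sweeps
    (n m N : ℕ) (f : (Fin n → ℝ) × (Fin m → ℝ) → (Fin n → ℝ))
    (𝒰 : Set (Fin m → ℝ)) (Ω : Fin N → Set (Fin n → ℝ))
    (M : Set (Fin n → ℝ))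
    (hMΩ : M ⊆ ⋃ j, Ω j)
    (hinv : ∀ x ∈ M, ∃ u ∈ 𝒰, f (x, u) ∈ M) :
    (∀ k : ℕ, M ⊆ ⋃ j, (sweep f 𝒰)^[k] Ω j) ∧
    (∀ k t : ℕ,
      M ⊆ ⋃ j, (((List.finRange N).take t).foldl (stepAt f 𝒰) ((sweep f 𝒰)^[k] Ω)) j) := by
  have hsweep : ∀ k : ℕ, M ⊆ ⋃ j, (sweep f 𝒰)^[k] Ω j := by
    intro k
    induction k with
    | zero => exact hMΩ
    | succ k ih =>
      rw [Function.iterate_succ_apply']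
      exact subset_iUnion_foldl_stepAt hinv _ ih
  exact ⟨hsweep, fun k t => subset_iUnion_foldl_stepAt hinv _ (hsweep k)⟩
end

section
/- Let f : ℝⁿ × ℝᵐ → ℝⁿ, 𝒰 ⊆ ℝᵐ, and let Ω₁,…,Ω_N ⊆ ℝⁿ with Ω = ⋃_{i=1}^N Ω_i. For k ≥ 0, let (I_{1:N})^k(Ω) denote the union of the collection obtained from (Ω₁,…,Ω_N) after k full sweeps (each sweep replaces, in order for i = 1,…,N, the i-th component by Q(current union) ∩ (current i-th component), where Q(S) = {x : ∃ u ∈ 𝒰, f(x, u) ∈ S}), and let I^k(Ω) be the k-th iterate of I(S) = Q(S) ∩ S starting from Ω. Then (I_{1:N})^k(Ω) ⊆ I^k(Ω) for every k ≥ 0. -/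
/-- The pre-set operator is monotone. -/
theorem preSet_mono {n m : ℕ} (f : (Fin n → ℝ) × (Fin m → ℝ) → (Fin n → ℝ))
    (𝒰 : Set (Fin m → ℝ)) : Monotone (preSet f 𝒰) :=
  fun _ _ h _ ⟨u, hu, hx⟩ => ⟨u, hu, h hx⟩

/-- Each component update shrinks the collection. -/
theorem stepAt_le {n m N : ℕ} (f : (Fin n → ℝ) × (Fin m → ℝ) → (Fin n → ℝ))
    (𝒰 : Set (Fin m → ℝ)) (C : Fin N → Set (Fin n → ℝ)) (i : Fin N) :
    stepAt f 𝒰 C i ≤ C :=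
  update_le_self_iff.2 Set.inter_subset_right

/-- A sequence of component updates shrinks the collection. -/
theorem foldl_stepAt_le {n m N : ℕ} (f : (Fin n → ℝ) × (Fin m → ℝ) → (Fin n → ℝ))
    (𝒰 : Set (Fin m → ℝ)) (l : List (Fin N)) (C : Fin N → Set (Fin n → ℝ)) :
    l.foldl (stepAt f 𝒰) C ≤ C := by
  induction l generalizing C with
  | nil => exact le_rfl
  | cons i l ih => exact (ih _).trans (stepAt_le f 𝒰 C i)

/-- Every component that has been updated lies in the pre-set of the initial union. -/
theorem foldl_stepAt_subset_preSet {n m N : ℕ}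
    (f : (Fin n → ℝ) × (Fin m → ℝ) → (Fin n → ℝ)) (𝒰 : Set (Fin m → ℝ))
    (l : List (Fin N)) (C : Fin N → Set (Fin n → ℝ)) {j : Fin N} (hj : j ∈ l) :
    l.foldl (stepAt f 𝒰) C j ⊆ preSet f 𝒰 (⋃ i, C i) := by
  induction l generalizing C with
  | nil => simp at hj
  | cons i l ih =>
    rcases List.mem_cons.1 hj with rfl | hj
    · refine (foldl_stepAt_le f 𝒰 l (stepAt f 𝒰 C j) j).trans ?_
      simp [stepAt]
    · exact (ih _ hj).trans (preSet_mono f 𝒰 (Set.iUnion_mono (stepAt_le f 𝒰 C i)))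

/-- The union after one sweep is contained in `I` of the union before it. -/
theorem iUnion_sweep_subset {n m N : ℕ} (f : (Fin n → ℝ) × (Fin m → ℝ) → (Fin n → ℝ))
    (𝒰 : Set (Fin m → ℝ)) (C : Fin N → Set (Fin n → ℝ)) :
    (⋃ j, sweep f 𝒰 C j) ⊆ preSet f 𝒰 (⋃ j, C j) ∩ ⋃ j, C j :=
  Set.subset_inter
    (Set.iUnion_subset fun j => foldl_stepAt_subset_preSet f 𝒰 _ C (List.mem_finRange j))
    (Set.iUnion_mono (foldl_stepAt_le f 𝒰 _ C))

/- The union of the collection after `k` full sweeps is contained in the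
`k`-th iterate of `I(S) = Q(S) ∩ S` starting from `Ω = ⋃ᵢ Ωᵢ`. -/
theorem sweep_iterates_subset_I_iterates
    (n m N : ℕ) (f : (Fin n → ℝ) × (Fin m → ℝ) → (Fin n → ℝ))
    (𝒰 : Set (Fin m → ℝ)) (Ω : Fin N → Set (Fin n → ℝ)) :
    ∀ k : ℕ,
      (⋃ j, (sweep f 𝒰)^[k] Ω j) ⊆
        (fun S => preSet f 𝒰 S ∩ S)^[k] (⋃ j, Ω j) := by
  intro k
  induction k with
  | zero => exact subset_rfl
  | succ k ih =>
    rw [Function.iterate_succ_apply', Function.iterate_succ_apply']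
    exact (iUnion_sweep_subset f 𝒰 _).trans (Set.inter_subset_inter (preSet_mono f 𝒰 ih) ih)
end
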